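/- arXiv:math/0310445 — 7 statements merged into one kernel-verified Lean document; each statement's English description precedes it below -/
import Mathlib

section
/- Let V be a finite-dimensional real vector space, B a nondegenerate symmetric bilinear form on V, and A : V → V a linear automorphism with B(Au,Av) = B(u,v) for all u,v. Then the Cartan–Dirac subspace L_A = {(v − A v, B♭(½(v + A v))) : v ∈ V} ⊆ V ⊕ V* is lagrangian for the canonical pairing ⟨·,·⟩₊: the pairing vanishes identically on L_A, the map v ↦ (v − A v, B♭(½(v + A v))) is injective, and dim L_A = dim V. -/
/-- The symmetric pairing `⟨(X,α),(Y,β)⟩₊ = β(X) + α(Y)` on `V ⊕ V*`. -/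
noncomputable def pairPlus {V : Type*} [AddCommGroup V] [Module ℝ V]
    (p q : V × Module.Dual ℝ V) : ℝ := q.2 p.1 + p.2 q.1

/-- The map `v ↦ (v − A v, B♭(½(v + A v)))` whose range is the Cartan–Dirac subspace. -/
noncomputable def cartanMap {V : Type*} [AddCommGroup V] [Module ℝ V]
    (B : LinearMap.BilinForm ℝ V) (A : V ≃ₗ[ℝ] V) :
    V →ₗ[ℝ] V × Module.Dual ℝ V :=
  LinearMap.prod (LinearMap.id - A.toLinearMap)
    (B ∘ₗ ((1 / 2 : ℝ) • (LinearMap.id + A.toLinearMap)))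

/-- The Cartan–Dirac subspace `L_A = {(v − A v, B♭(½(v + A v))) : v ∈ V}` is lagrangian:
the pairing `⟨·,·⟩₊` vanishes on it, the parametrizing map is injective, and it has
dimension `dim V`. -/
theorem cartanDirac_isLagrangian
    {V : Type*} [AddCommGroup V] [Module ℝ V] [FiniteDimensional ℝ V]
    (B : LinearMap.BilinForm ℝ V)
    (hBsymm : ∀ u v, B u v = B v u) (hBnd : B.Nondegenerate)
    (A : V ≃ₗ[ℝ] V) (hA : ∀ u v, B (A u) (A v) = B u v) :
    (∀ p ∈ LinearMap.range (cartanMap B A), ∀ q ∈ LinearMap.range (cartanMap B A),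
        pairPlus p q = 0)
    ∧ Function.Injective (cartanMap B A)
    ∧ Module.finrank ℝ (LinearMap.range (cartanMap B A)) = Module.finrank ℝ V := by
  have hinj : Function.Injective (cartanMap B A) := by
    rw [← LinearMap.ker_eq_bot, LinearMap.ker_eq_bot']
    intro v hv
    have h1 : v - A v = 0 := by simpa [cartanMap] using congrArg Prod.fst hv
    have h2 : B ((1 / 2 : ℝ) • (v + A v)) = 0 := congrArg Prod.snd hv
    have h3 : A v = v := (sub_eq_zero.mp h1).symm
    have h4 : (1 / 2 : ℝ) • (v + A v) = v := by
      rw [h3, ← two_smul ℝ v, smul_smul]; norm_num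
    rw [h4] at h2
    exact hBnd.1 v (fun w => by rw [h2]; rfl)
  refine ⟨?_, hinj, LinearMap.finrank_range_of_inj hinj⟩
  rintro _ ⟨u, rfl⟩ _ ⟨v, rfl⟩
  change B ((1 / 2 : ℝ) • (v + A v)) (u - A u) + B ((1 / 2 : ℝ) • (u + A u)) (v - A v) = 0
  simp only [map_smul, map_add, map_sub, LinearMap.smul_apply, LinearMap.add_apply, smul_eq_mul]
  rw [hA, hA, hBsymm v u, hBsymm v (A u), hBsymm (A v) u]
  ring
end

section
/- Let V be a finite-dimensional real vector space, B a nondegenerate symmetric bilinear form on V, and A : V → V a linear automorphism with B(Au,Av) = B(u,v). Then the prescription θ_A((id − A)u, (id − A)v) := ½ B((A − A⁻¹)u, v) gives a well-defined bilinear form on the subspace W = range(id − A) ⊆ V; that is, if (id − A)u = (id − A)u' and (id − A)v = (id − A)v', then B((A − A⁻¹)u, v) = B((A − A⁻¹)u', v'). Moreover θ_A is skew-symmetric: θ_A(x,y) = −θ_A(y,x) for all x, y ∈ W. -/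
/-- The prescription `θ_A((id − A)u, (id − A)v) := ½ B((A − A⁻¹)u, v)` is well defined on
`W = range(id − A)` (independent of the chosen preimages), and it is skew-symmetric. -/
theorem GHJW_form_wellDefined_skew
    {V : Type*} [AddCommGroup V] [Module ℝ V] [FiniteDimensional ℝ V]
    (B : LinearMap.BilinForm ℝ V)
    (hBsymm : ∀ u v, B u v = B v u) (hBnd : B.Nondegenerate)
    (A : V ≃ₗ[ℝ] V) (hA : ∀ u v, B (A u) (A v) = B u v) :
    (∀ u u' v v' : V, u - A u = u' - A u' → v - A v = v' - A v' →
        B (A u - A.symm u) v = B (A u' - A.symm u') v')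
    ∧ (∀ u v : V,
        (1 / 2 : ℝ) * B (A u - A.symm u) v = -((1 / 2 : ℝ) * B (A v - A.symm v) u)) := by
  have hs : ∀ u v, B (A.symm u) v = B u (A v) := fun u v => by
    rw [← hA (A.symm u) v, A.apply_symm_apply]
  have hskew : ∀ u v, B (A u - A.symm u) v = -B (A v - A.symm v) u := fun u v => by
    simp only [map_sub, LinearMap.sub_apply, hs]
    rw [hBsymm (A u) v, hBsymm (A v) u]
    ring
  have hk : ∀ u u', u - A u = u' - A u' → A u - A.symm u = A u' - A.symm u' := fun u u' h => by
    have h2 := congrArg A.symm h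
    simp only [map_sub, A.symm_apply_apply] at h2
    have e : ∀ w, A w - A.symm w = -(w - A w) - (A.symm w - w) := fun w => by abel
    rw [e u, e u', h, h2]
  refine ⟨fun u u' v v' hu hv => ?_, fun u v => ?_⟩
  · rw [hk u u' hu, hskew u' v, hk v v' hv, ← hskew u' v']
  · rw [hskew u v]
    ring
end

section
/- Let V be a finite-dimensional real vector space, B a nondegenerate symmetric bilinear form on V, and A : V → V a linear automorphism with B(Au,Av) = B(u,v). Let θ_A be the skew bilinear form on W = range(id − A) determined by θ_A((id − A)u, (id − A)v) = ½ B((A − A⁻¹)u, v). Then the kernel of θ_A, namely {x ∈ W : θ_A(x,y) = 0 for all y ∈ W}, equals {(id − A)v : A v = −v} = {2v : A v = −v}. Consequently θ_A is nondegenerate on W if and only if id + A is injective. -/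
/-- The kernel of the GHJW form `θ_A` on `W = range(id − A)`, namely the set of
`x = (id − A)u ∈ W` pairing to zero with every element of `W`, equals
`{(id − A)v : A v = −v} = {2v : A v = −v}`; hence `θ_A` is nondegenerate on `W`
iff `id + A` is injective. -/
theorem GHJW_form_kernel
    {V : Type*} [AddCommGroup V] [Module ℝ V] [FiniteDimensional ℝ V]
    (B : LinearMap.BilinForm ℝ V)
    (hBsymm : ∀ u v, B u v = B v u) (hBnd : B.Nondegenerate)
    (A : V ≃ₗ[ℝ] V) (hA : ∀ u v, B (A u) (A v) = B u v) :
    ({x : V | ∃ u, x = u - A u ∧ ∀ v : V, (1 / 2 : ℝ) * B (A u - A.symm u) v = 0}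
        = {x : V | ∃ v, A v = -v ∧ x = v - A v})
    ∧ ({x : V | ∃ v, A v = -v ∧ x = v - A v}
        = {x : V | ∃ v, A v = -v ∧ x = (2 : ℝ) • v})
    ∧ (({x : V | ∃ u, x = u - A u ∧ ∀ v : V, (1 / 2 : ℝ) * B (A u - A.symm u) v = 0}
          = {0})
        ↔ Function.Injective (LinearMap.id + A.toLinearMap : V →ₗ[ℝ] V)) := by
  have key : ∀ u : V, (∀ v : V, (1 / 2 : ℝ) * B (A u - A.symm u) v = 0) ↔ A (A u) = u := by
    intro u
    constructor
    · intro h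
      have h0 : A u - A.symm u = 0 := by
        apply hBnd.1
        intro v
        have := h v
        linarith
      have h1 : A u = A.symm u := sub_eq_zero.mp h0
      rw [h1, LinearEquiv.apply_symm_apply]
    · intro h v
      have h1 : A u = A.symm u := by
        rw [LinearEquiv.eq_symm_apply]
        exact h
      rw [h1]
      simp
  have two : ∀ v : V, A v = -v → v - A v = (2 : ℝ) • v := by
    intro v hv
    rw [hv, two_smul, sub_neg_eq_add]
  have E1 : {x : V | ∃ u, x = u - A u ∧ ∀ v : V, (1 / 2 : ℝ) * B (A u - A.symm u) v = 0}
        = {x : V | ∃ v, A v = -v ∧ x = v - A v} := by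
    ext x
    simp only [Set.mem_setOf_eq, key]
    constructor
    · rintro ⟨u, rfl, h⟩
      have hv : A ((1 / 2 : ℝ) • (u - A u)) = -((1 / 2 : ℝ) • (u - A u)) := by
        rw [map_smul, map_sub, h, ← smul_neg, neg_sub]
      refine ⟨(1 / 2 : ℝ) • (u - A u), hv, ?_⟩
      rw [two _ hv, smul_smul]
      norm_num
    · rintro ⟨v, hv, rfl⟩
      exact ⟨v, rfl, by rw [hv, map_neg, hv, neg_neg]⟩
  refine ⟨E1, ?_, ?_⟩
  · ext x
    simp only [Set.mem_setOf_eq]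
    constructor
    · rintro ⟨v, hv, rfl⟩
      exact ⟨v, hv, two v hv⟩
    · rintro ⟨v, hv, rfl⟩
      exact ⟨v, hv, (two v hv).symm⟩
  · rw [E1, injective_iff_map_eq_zero]
    constructor
    · intro h v hv
      have hv' : A v = -v := by
        have h2 : v + A v = 0 := by simpa using hv
        exact (neg_eq_of_add_eq_zero_right h2).symm
      have hm : v - A v ∈ ({0} : Set V) := by
        rw [← h]
        exact ⟨v, hv', rfl⟩
      rw [Set.mem_singleton_iff, two v hv'] at hm
      exact (smul_eq_zero.mp hm).resolve_left two_ne_zero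
    · intro h
      ext x
      simp only [Set.mem_setOf_eq, Set.mem_singleton_iff]
      constructor
      · rintro ⟨v, hv, rfl⟩
        have h0 : v = 0 := h v (by simp [hv])
        simp [h0]
      · rintro rfl
        exact ⟨0, by simp, by simp⟩
end

section
/- Let V be a finite-dimensional real vector space, B a nondegenerate symmetric bilinear form on V, and A : V → V a linear automorphism with B(Au,Av) = B(u,v). Let L_A = {(v − A v, B♭(½(v + A v))) : v ∈ V} ⊆ V ⊕ V*, and let θ_{L_A} be the canonical bilinear form on pr₁(L_A) = range(id − A) defined by θ_{L_A}(X₁, X₂) = α(X₂) for any α ∈ V* with (X₁, α) ∈ L_A. Then θ_{L_A} coincides with the GHJW form: θ_{L_A}((id − A)u, (id − A)v) = ½ B((A − A⁻¹)u, v) for all u, v ∈ V. -/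
/-- The canonical bilinear form of the Cartan–Dirac subspace `L_A` coincides with the GHJW
form: for any `α` with `((id − A)u, α) ∈ L_A` one has
`α((id − A)v) = ½ B((A − A⁻¹)u, v)`. -/
theorem cartanDirac_canonical_form_eq_GHJW
    {V : Type*} [AddCommGroup V] [Module ℝ V] [FiniteDimensional ℝ V]
    (B : LinearMap.BilinForm ℝ V)
    (hBsymm : ∀ u v, B u v = B v u) (hBnd : B.Nondegenerate)
    (A : V ≃ₗ[ℝ] V) (hA : ∀ u v, B (A u) (A v) = B u v) :
    ∀ (u v : V) (α : Module.Dual ℝ V),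
      (u - A u, α) ∈ LinearMap.range (cartanMap B A) →
      α (v - A v) = (1 / 2 : ℝ) * B (A u - A.symm u) v := by
  rintro u v α ⟨w, hw⟩
  have h1 : w - A w = u - A u := by simpa [cartanMap] using congrArg Prod.fst hw
  have h2 : B ((1 / 2 : ℝ) • (w + A w)) = α := by
    simpa [cartanMap] using congrArg Prod.snd hw
  have hd : A (w - u) = w - u := by
    rw [map_sub, ← sub_eq_zero]
    have h := sub_eq_zero.mpr h1
    rw [← neg_eq_zero, ← h]
    abel
  have hd' : A.symm (w - u) = w - u := by
    rw [LinearEquiv.symm_apply_eq]; exact hd.symm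
  have hk : A u - A.symm u = A w - A.symm w := by
    have h : A (w - u) - A.symm (w - u) = 0 := by rw [hd, hd', sub_self]
    rw [map_sub, map_sub] at h
    rw [eq_comm, ← sub_eq_zero, ← h]
    abel
  have hs : B w (A v) = B (A.symm w) v := by
    rw [← hA (A.symm w) v, LinearEquiv.apply_symm_apply]
  rw [hk, ← h2]
  simp only [map_smul, map_add, map_sub, LinearMap.smul_apply, LinearMap.add_apply,
    LinearMap.sub_apply, smul_eq_mul, hA, hs]
  ring
end

section
/- Let V be a finite-dimensional real vector space, B a nondegenerate symmetric bilinear form on V, and A : V → V a linear automorphism with B(Au,Av) = B(u,v). Let T be a finite-dimensional real vector space and r : V → T, d : T → V, p : T* → T linear maps such that: (i) α(pβ) = −β(pα) for all α, β ∈ T*; (ii) d ∘ r = id_V − A; (iii) p(J*a) = ½ r(a + A⁻¹a) for all a ∈ V, where J* : V → T* is defined by (J*a)(Y) = B(a, dY). Define C = id_T − ¼ r ∘ (id_V − A⁻¹) ∘ d, j : V → T* × V by j(a) = (−J*a, ½(a + A⁻¹a)), and F : T* × V → T × T* by F(α, v) = (pα + r(v), α ∘ C + J*(½(v + Av))). Then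 j is injective, F ∘ j = 0, and ker F = im j; in particular, the image of F has dimension equal to dim T. -/
/-- Pointwise form of the exact sequence `0 → T*G → T*M ⊕ 𝔤 → L → 0` for a quasi-Poisson
manifold with moment map: under the skewness of `p`, the equivariance `d ∘ r = id − A`,
and the moment map condition `p ∘ J* = ½ r(id + A⁻¹)`, the map
`j(a) = (−J*a, ½(a + A⁻¹a))` is injective, `F ∘ j = 0`, `ker F = im j`, and the image of
`F(α,v) = (pα + r v, α∘C + J*(½(v + Av)))` has dimension `dim T`. -/
theorem quasiPoisson_exact_sequence
    {V : Type*} [AddCommGroup V] [Module ℝ V] [FiniteDimensional ℝ V]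
    {T : Type*} [AddCommGroup T] [Module ℝ T] [FiniteDimensional ℝ T]
    (B : LinearMap.BilinForm ℝ V)
    (hBsymm : ∀ u v, B u v = B v u) (hBnd : B.Nondegenerate)
    (A : V ≃ₗ[ℝ] V) (hA : ∀ u v, B (A u) (A v) = B u v)
    (r : V →ₗ[ℝ] T) (d : T →ₗ[ℝ] V) (p : Module.Dual ℝ T →ₗ[ℝ] T)
    (hskew : ∀ α β : Module.Dual ℝ T, α (p β) = -(β (p α)))
    (hdr : d ∘ₗ r = LinearMap.id - A.toLinearMap)
    (Jstar : V →ₗ[ℝ] Module.Dual ℝ T)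
    (hJstar : ∀ (a : V) (Y : T), Jstar a Y = B a (d Y))
    (hmom : ∀ a : V, p (Jstar a) = (1 / 2 : ℝ) • r (a + A.symm a))
    (C : T →ₗ[ℝ] T)
    (hC : C = LinearMap.id -
        (1 / 4 : ℝ) • (r ∘ₗ (LinearMap.id - A.symm.toLinearMap) ∘ₗ d))
    (j : V →ₗ[ℝ] Module.Dual ℝ T × V)
    (hj : ∀ a : V, j a = (-(Jstar a), (1 / 2 : ℝ) • (a + A.symm a)))
    (F : Module.Dual ℝ T × V →ₗ[ℝ] T × Module.Dual ℝ T)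
    (hF : ∀ (α : Module.Dual ℝ T) (v : V),
        F (α, v) = (p α + r v, α ∘ₗ C + Jstar ((1 / 2 : ℝ) • (v + A v)))) :
    Function.Injective j
    ∧ F ∘ₗ j = 0
    ∧ LinearMap.ker F = LinearMap.range j
    ∧ Module.finrank ℝ (LinearMap.range F) = Module.finrank ℝ T := by
  have hdr' : ∀ v, d (r v) = v - A v := fun v => by
    have := LinearMap.congr_fun hdr v
    simpa using this
  have hA1 : ∀ u v, B (A u) v = B u (A.symm v) := fun u v => by
    have := hA u (A.symm v)
    simpa using this
  have hA2 : ∀ u v, B (A.symm u) v = B u (A v) := fun u v => by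
    have := hA (A.symm u) v
    simpa using this.symm
  have hCa : ∀ Y, C Y = Y - (1 / 4 : ℝ) • r (d Y - A.symm (d Y)) := fun Y => by
    rw [hC]; simp
  have hzero : ∀ a, (∀ u, B a u = 0) → a = 0 := fun a h => hBnd.1 a h
  have hinj : Function.Injective j := by
    rw [← LinearMap.ker_eq_bot, LinearMap.ker_eq_bot']
    intro a ha
    rw [hj, Prod.mk_eq_zero] at ha
    obtain ⟨h1, h2⟩ := ha
    have h3 : A.symm a = -a := by
      have : a + A.symm a = 0 := (smul_eq_zero.mp h2).resolve_left (by norm_num)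
      exact (neg_eq_of_add_eq_zero_right this).symm
    apply hzero
    intro u
    have h4 : Jstar a (r u) = 0 := by
      rw [neg_eq_zero.mp h1]; rfl
    rw [hJstar, hdr', map_sub, ← hA2, h3] at h4
    simp at h4
    linarith
  have hcomp : F ∘ₗ j = 0 := by
    ext1 a
    rw [LinearMap.comp_apply, hj, hF]
    refine Prod.ext ?_ ?_
    · simp [hmom]
    · ext Y
      simp [hJstar, hCa, hdr', hA1, hA2]
      ring
  have hker : LinearMap.ker F = LinearMap.range j := by
    apply le_antisymm
    · rintro ⟨α, v⟩ hx
      rw [LinearMap.mem_ker, hF, Prod.mk_eq_zero] at hx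
      obtain ⟨h1, h2⟩ := hx
      obtain ⟨w, hw⟩ : ∃ w, ∀ u, B w u = α (r u) :=
        ⟨(B.toDual hBnd).symm (α ∘ₗ r), fun u => by simp⟩
      obtain ⟨a, ha⟩ : ∃ a, a = (1 / 2 : ℝ) • (v + A v) - (1 / 4 : ℝ) • (w - A w) := ⟨_, rfl⟩
      have hα : α = -(Jstar a) := by
        ext Y
        have h := LinearMap.congr_fun h2 Y
        simp [hJstar, hCa, ← hw] at h
        simp [hJstar, ha, hA1] at h ⊢
        linarith
      have hw' : w = A.symm a - a := by
        rw [← sub_eq_zero]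
        apply hzero
        intro u
        have := hw u
        rw [hα] at this
        simp [hJstar, hdr'] at this
        simp [hA2, this]
      obtain ⟨x, hx⟩ : ∃ x, x = v - (1 / 2 : ℝ) • (a + A.symm a) := ⟨_, rfl⟩
      have hrx : r x = 0 := by
        rw [hα, map_neg, hmom] at h1
        rw [hx, map_sub, map_smul, ← h1]; abel
      have hx1 : x - A x = 0 := by rw [← hdr', hrx, map_zero]
      have hx2 : x + A x = 0 := by
        rw [hw'] at ha
        simp at ha
        rw [hx]
        simp
        linear_combination (norm := module) (-2 : ℝ) • ha
      have hx0 : x = 0 := by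
        linear_combination (norm := module) (1 / 2 : ℝ) • hx1 + (1 / 2 : ℝ) • hx2
      refine ⟨a, ?_⟩
      rw [hj, hα]
      refine Prod.ext rfl ?_
      rw [hx0] at hx
      exact (sub_eq_zero.mp hx.symm).symm
    · exact LinearMap.range_le_ker_iff.mpr hcomp
  refine ⟨hinj, hcomp, hker, ?_⟩
  have h1 := LinearMap.finrank_range_add_finrank_ker F
  rw [hker, LinearMap.finrank_range_of_inj hinj, Module.finrank_prod,
    Subspace.dual_finrank_eq] at h1
  omega
end

section
/- Let W and V be finite-dimensional real vector spaces, f : W → V a linear map, and L ⊆ V ⊕ V* a lagrangian subspace for the pairing ⟨(X,α),(Y,β)⟩₊ = β(X) + α(Y). Then the backward image f^*L = {(Y, α ∘ f) : Y ∈ W, α ∈ V*, (f(Y), α) ∈ L} is a lagrangian subspace of W ⊕ W*. -/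
/-- `L ⊆ V ⊕ V*` is lagrangian if the pairing vanishes on `L` and `dim L = dim V`. -/
def IsLagrangian {V : Type*} [AddCommGroup V] [Module ℝ V]
    (L : Submodule ℝ (V × Module.Dual ℝ V)) : Prop :=
  (∀ p ∈ L, ∀ q ∈ L, pairPlus p q = 0) ∧ Module.finrank ℝ L = Module.finrank ℝ V

/-- The backward image `f^*L = {(Y, α∘f) : (f Y, α) ∈ L} ⊆ W ⊕ W*`. -/
def backwardImage {W V : Type*} [AddCommGroup W] [Module ℝ W] [AddCommGroup V] [Module ℝ V]
    (f : W →ₗ[ℝ] V) (L : Submodule ℝ (V × Module.Dual ℝ V)) :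
    Submodule ℝ (W × Module.Dual ℝ W) :=
  Submodule.map
    ((LinearMap.fst ℝ W (Module.Dual ℝ V)).prod
      (f.dualMap ∘ₗ LinearMap.snd ℝ W (Module.Dual ℝ V)))
    (Submodule.comap (f.prodMap (LinearMap.id : Module.Dual ℝ V →ₗ[ℝ] Module.Dual ℝ V)) L)

theorem finrank_map_add_inf_ker {E F : Type*} [AddCommGroup E] [Module ℝ E]
    [FiniteDimensional ℝ E] [AddCommGroup F] [Module ℝ F] (g : E →ₗ[ℝ] F) (p : Submodule ℝ E) :
    Module.finrank ℝ (p.map g) + Module.finrank ℝ (p ⊓ LinearMap.ker g : Submodule ℝ E)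
      = Module.finrank ℝ p := by
  have h := LinearMap.finrank_range_add_finrank_ker (g ∘ₗ p.subtype)
  rw [LinearMap.range_comp, Submodule.range_subtype, LinearMap.ker_comp] at h
  rw [← h, ← Submodule.map_comap_subtype,
    Submodule.finrank_map_subtype_eq]

/-- The pairing as a bilinear form. -/
noncomputable def pairForm (V : Type*) [AddCommGroup V] [Module ℝ V] :
    LinearMap.BilinForm ℝ (V × Module.Dual ℝ V) :=
  LinearMap.mk₂ ℝ pairPlus
    (by intros; simp [pairPlus]; ring) (by intros; simp [pairPlus]; ring)
    (by intros; simp [pairPlus]; ring) (by intros; simp [pairPlus]; ring)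

theorem pairForm_ker (V : Type*) [AddCommGroup V] [Module ℝ V] :
    LinearMap.ker (pairForm V) = ⊥ := by
  rw [eq_bot_iff]
  rintro ⟨X, α⟩ h
  have h' : ∀ q, pairPlus (X, α) q = 0 := fun q => LinearMap.congr_fun h q
  have h1 : X = 0 := (Module.forall_dual_apply_eq_zero_iff ℝ X).1 fun β => by
    simpa [pairPlus] using h' (0, β)
  have h2 : α = 0 := LinearMap.ext fun Y => by simpa [pairPlus] using h' (Y, 0)
  simp [h1, h2]

theorem finrank_orth {V : Type*} [AddCommGroup V] [Module ℝ V] [FiniteDimensional ℝ V]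
    (N : Submodule ℝ (V × Module.Dual ℝ V)) :
    Module.finrank ℝ N + Module.finrank ℝ ((pairForm V).orthogonal N)
      = 2 * Module.finrank ℝ V := by
  have h := LinearMap.BilinForm.finrank_add_finrank_orthogonal' (B := pairForm V) N
  rw [pairForm_ker, inf_bot_eq, finrank_bot, Module.finrank_prod, Subspace.dual_finrank_eq] at h
  omega

theorem orth_eq {V : Type*} [AddCommGroup V] [Module ℝ V] [FiniteDimensional ℝ V]
    (L : Submodule ℝ (V × Module.Dual ℝ V)) (hL : IsLagrangian L) :
    (pairForm V).orthogonal L = L := by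
  have h := finrank_orth L
  have h2 := hL.2
  have h3 : L ≤ (pairForm V).orthogonal L := fun q hq p hp => hL.1 p hp q hq
  exact (Submodule.eq_of_le_of_finrank_eq h3 (by omega)).symm

/-- The backward image of a lagrangian subspace under a linear map is lagrangian. -/
theorem backwardImage_isLagrangian
    {W V : Type*} [AddCommGroup W] [Module ℝ W] [FiniteDimensional ℝ W]
    [AddCommGroup V] [Module ℝ V] [FiniteDimensional ℝ V]
    (f : W →ₗ[ℝ] V) (L : Submodule ℝ (V × Module.Dual ℝ V)) (hL : IsLagrangian L) :
    ((backwardImage f L : Set (W × Module.Dual ℝ W))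
        = {p | ∃ α : Module.Dual ℝ V, (f p.1, α) ∈ L ∧ p.2 = α ∘ₗ f})
    ∧ IsLagrangian (backwardImage f L) := by
  refine ⟨?_, ?_, ?_⟩
  · ext ⟨Y, γ⟩
    simp only [backwardImage, SetLike.mem_coe, Submodule.mem_map, Submodule.mem_comap,
      Set.mem_ofPred_eq]
    constructor
    · rintro ⟨⟨Y', α⟩, h, h'⟩
      cases h'
      exact ⟨α, h, rfl⟩
    · rintro ⟨α, h, h'⟩
      exact ⟨(Y, α), h, Prod.ext rfl h'.symm⟩
  · rintro _ ⟨⟨Y, α⟩, h, rfl⟩ _ ⟨⟨Z, β⟩, h', rfl⟩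
    exact hL.1 _ h _ h'
  · unfold backwardImage
    set A := f.prodMap (LinearMap.id : Module.Dual ℝ V →ₗ[ℝ] Module.Dual ℝ V) with hA
    set B := (LinearMap.fst ℝ W (Module.Dual ℝ V)).prod
      (f.dualMap ∘ₗ LinearMap.snd ℝ W (Module.Dual ℝ V)) with hB
    have e1 := finrank_map_add_inf_ker B (L.comap A)
    have e2 := finrank_map_add_inf_ker A (L.comap A)
    rw [Submodule.map_comap_eq, inf_eq_right.2 (LinearMap.ker_le_comap A)] at e2
    have e3 := LinearMap.finrank_range_add_finrank_ker A
    rw [Module.finrank_prod, Subspace.dual_finrank_eq] at e3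
    have e4 := Submodule.finrank_sup_add_finrank_inf_eq (LinearMap.range A) L
    have e5 := finrank_orth (LinearMap.range A ⊔ L)
    have e6 := hL.2
    let K : Submodule ℝ (Module.Dual ℝ V) :=
      L.comap (LinearMap.inr ℝ V (Module.Dual ℝ V)) ⊓ LinearMap.ker f.dualMap
    have k1 : L.comap A ⊓ LinearMap.ker B
        = K.map (LinearMap.inr ℝ W (Module.Dual ℝ V)) := by
      ext ⟨Y, α⟩
      constructor
      · rintro ⟨h, h'⟩
        have hY : Y = 0 := congrArg Prod.fst h'
        have hα : f.dualMap α = 0 := congrArg Prod.snd h'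
        subst hY
        refine ⟨α, ⟨?_, hα⟩, rfl⟩
        have h2 : (f 0, α) ∈ L := h
        rw [map_zero] at h2
        exact h2
      · rintro ⟨α, ⟨h, h'⟩, h2⟩
        cases h2
        refine ⟨?_, Prod.ext rfl h'⟩
        change (f 0, α) ∈ L
        rw [map_zero]
        exact h
    have k2 : (pairForm V).orthogonal (LinearMap.range A ⊔ L)
        = K.map (LinearMap.inr ℝ V (Module.Dual ℝ V)) := by
      ext ⟨X, β⟩
      constructor
      · intro h
        have hl : (X, β) ∈ L := by
          rw [← orth_eq L hL]
          exact LinearMap.BilinForm.orthogonal_le le_sup_right h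
        have hr : ∀ (Y : W) (α : Module.Dual ℝ V), β (f Y) + α X = 0 := fun Y α =>
          h (A (Y, α)) (Submodule.mem_sup_left ⟨(Y, α), rfl⟩)
        have hX : X = 0 := (Module.forall_dual_apply_eq_zero_iff ℝ X).1 fun α => by
          simpa using hr 0 α
        subst hX
        exact ⟨β, ⟨hl, LinearMap.ext fun Y => by simpa using hr Y 0⟩, rfl⟩
      · rintro ⟨β, ⟨h, h'⟩, h2⟩
        cases h2
        intro n hn
        obtain ⟨_, ⟨⟨Y, α⟩, rfl⟩, q, hq, rfl⟩ := Submodule.mem_sup.1 hn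
        have t1 : pairForm V (A (Y, α)) (0, β) = 0 := by
          change β (f Y) + α 0 = 0
          rw [map_zero, add_zero]
          exact LinearMap.congr_fun h' Y
        have t2 : pairForm V q (0, β) = 0 := hL.1 q hq _ h
        change pairForm V (A (Y, α) + q) (0, β) = 0
        rw [map_add, LinearMap.add_apply, t1, t2, add_zero]
    have k3 : Module.finrank ℝ (K.map (LinearMap.inr ℝ W (Module.Dual ℝ V)))
        = Module.finrank ℝ K :=
      (Submodule.equivMapOfInjective _ LinearMap.inr_injective K).finrank_eq.symm
    have k4 : Module.finrank ℝ (K.map (LinearMap.inr ℝ V (Module.Dual ℝ V)))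
        = Module.finrank ℝ K :=
      (Submodule.equivMapOfInjective _ LinearMap.inr_injective K).finrank_eq.symm
    rw [k1, k3] at e1
    rw [k2, k4] at e5
    omega
end

section
/- Let W and V be finite-dimensional real vector spaces, f : W → V a linear map, and L ⊆ W ⊕ W* a lagrangian subspace for the pairing ⟨(X,α),(Y,β)⟩₊ = β(X) + α(Y). Write ker(L) = {Y ∈ W : (Y, 0) ∈ L} and ker(f_*L) = {X ∈ V : (X, 0) ∈ f_*L}, where f_*L = {(f(Y), α) : (Y, α ∘ f) ∈ L}. Then f maps ker(L) onto ker(f_*L), and the restriction f|_{ker(L)} : ker(L) → ker(f_*L) is an isomorphism if and only if ker(f) ∩ ker(L) = {0}. -/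
/-- The forward image `f_*L = {(f Y, α) : (Y, α∘f) ∈ L} ⊆ V ⊕ V*`. -/
def forwardImage {W V : Type*} [AddCommGroup W] [Module ℝ W] [AddCommGroup V] [Module ℝ V]
    (f : W →ₗ[ℝ] V) (L : Submodule ℝ (W × Module.Dual ℝ W)) :
    Submodule ℝ (V × Module.Dual ℝ V) :=
  Submodule.map (f.prodMap (LinearMap.id : Module.Dual ℝ V →ₗ[ℝ] Module.Dual ℝ V))
    (Submodule.comap
      ((LinearMap.fst ℝ W (Module.Dual ℝ V)).prod
        (f.dualMap ∘ₗ LinearMap.snd ℝ W (Module.Dual ℝ V))) L)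

/-- `ker(L) = {Y : (Y,0) ∈ L}`. -/
def kerD {W : Type*} [AddCommGroup W] [Module ℝ W]
    (L : Submodule ℝ (W × Module.Dual ℝ W)) : Submodule ℝ W :=
  Submodule.comap (LinearMap.inl ℝ W (Module.Dual ℝ W)) L

/-- `f` maps `ker(L)` onto `ker(f_*L)`, and its restriction `ker(L) → ker(f_*L)` is an
isomorphism iff `ker(f) ∩ ker(L) = {0}`. -/
theorem kernel_nondegeneracy_of_forward
    {W V : Type*} [AddCommGroup W] [Module ℝ W] [FiniteDimensional ℝ W]
    [AddCommGroup V] [Module ℝ V] [FiniteDimensional ℝ V]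
    (f : W →ₗ[ℝ] V) (L : Submodule ℝ (W × Module.Dual ℝ W)) (hL : IsLagrangian L) :
    Submodule.map f (kerD L) = kerD (forwardImage f L)
    ∧ (Set.BijOn f (kerD L) (kerD (forwardImage f L)) ↔
        LinearMap.ker f ⊓ kerD L = ⊥) := by
  have h1 : Submodule.map f (kerD L) = kerD (forwardImage f L) := by
    ext x
    constructor
    · rintro ⟨y, hy, rfl⟩
      refine ⟨(y, 0), ?_, ?_⟩
      · have hy' : ((y, 0) : W × Module.Dual ℝ W) ∈ L := hy
        simpa using hy'
      · simp
    · rintro ⟨⟨y, a⟩, hy, he⟩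
      have h2 : f y = x := congrArg Prod.fst he
      have h3 : a = 0 := congrArg Prod.snd he
      subst h3
      refine ⟨y, ?_, h2⟩
      change ((y, 0) : W × Module.Dual ℝ W) ∈ L
      simpa using hy
  refine ⟨h1, ?_⟩
  rw [← h1]
  constructor
  · intro h
    rw [eq_bot_iff]
    rintro y ⟨hy1, hy2⟩
    have hy1' : f y = 0 := hy1
    exact h.injOn hy2 (kerD L).zero_mem (by rw [hy1', map_zero])
  · intro h
    refine ⟨fun y hy => ⟨y, hy, rfl⟩, ?_, ?_⟩
    · intro y hy z hz hyz
      have hm : y - z ∈ LinearMap.ker f ⊓ kerD L :=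
        ⟨by simp [hyz], (kerD L).sub_mem hy hz⟩
      rw [h] at hm
      exact sub_eq_zero.mp hm
    · rintro _ ⟨y, hy, rfl⟩
      exact ⟨y, hy, rfl⟩
end
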